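/- Let (H, μ, Δ, α_H) be a Hom-bialgebra with α_H bijective, and let (M, α_M), (N, α_N), (P, α_P) be Yetter-Drinfeld modules over H with bijective structure maps. Define 𝔞_{M,N,P}: (M⊗̃N)⊗̃P → M⊗̃(N⊗̃P) by 𝔞_{M,N,P}((m⊗n)⊗p) = α_M(m)⊗(n⊗α_P^{-1}(p)) and c_{M,N}: M⊗̃N → N⊗̃M by c_{M,N}(m⊗n) = α_N^{-1}(α_H^{-1}(m_{(-1)})·n)⊗α_M^{-1}(m_{(0)}). Then 𝔞_{M,N,P} is a bijective morphism of left H-modules and left H-comodules with respect to the iterated ⊗̃ structures, and c_{M,N} is a morphism of left H-modules and left H-comodules with respect to the ⊗̃ structures. -/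

import Mathlib

open TensorProduct

noncomputable section

namespace HomYD

variable (k : Type*) [Field k]
variable {H M N : Type*}
variable [AddCommGroup H] [Module k H]
variable [AddCommGroup M] [Module k M]
variable [AddCommGroup N] [Module k N]

/-- Rearrangement `(a ⊗ b) ⊗ c ↦ (a ⊗ c) ⊗ b`. -/
def rearr (A B C : Type*) [AddCommGroup A] [Module k A] [AddCommGroup B] [Module k B]
    [AddCommGroup C] [Module k C] :
    (A ⊗[k] B) ⊗[k] C →ₗ[k] (A ⊗[k] C) ⊗[k] B :=
  (TensorProduct.assoc k A C B).symm.toLinearMap ∘ₗ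
    (TensorProduct.map LinearMap.id (TensorProduct.comm k B C).toLinearMap) ∘ₗ
      (TensorProduct.assoc k A B C).toLinearMap

/-- Middle-four exchange `(a ⊗ b) ⊗ (c ⊗ d) ↦ (a ⊗ c) ⊗ (b ⊗ d)`. -/
def ttc (A B C D : Type*) [AddCommGroup A] [Module k A] [AddCommGroup B] [Module k B]
    [AddCommGroup C] [Module k C] [AddCommGroup D] [Module k D] :
    (A ⊗[k] B) ⊗[k] (C ⊗[k] D) →ₗ[k] (A ⊗[k] C) ⊗[k] (B ⊗[k] D) :=
  (TensorProduct.tensorTensorTensorComm k A B C D).toLinearMap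

/-- Hom-bialgebra (no unit/counit): multiplicativity of `α`, Hom-associativity,
comultiplicativity of `α`, Hom-coassociativity, and `Δ` multiplicative. -/
structure IsHomBialgebra (μ : H ⊗[k] H →ₗ[k] H) (Δ : H →ₗ[k] H ⊗[k] H)
    (α : H →ₗ[k] H) : Prop where
  mul_mult : ∀ a b : H, α (μ (a ⊗ₜ[k] b)) = μ (α a ⊗ₜ[k] α b)
  hom_assoc : ∀ a b c : H, μ (α a ⊗ₜ[k] μ (b ⊗ₜ[k] c)) = μ (μ (a ⊗ₜ[k] b) ⊗ₜ[k] α c)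
  comul_compat : TensorProduct.map α α ∘ₗ Δ = Δ ∘ₗ α
  hom_coassoc : (TensorProduct.assoc k H H H).toLinearMap ∘ₗ TensorProduct.map Δ α ∘ₗ Δ
      = TensorProduct.map α Δ ∘ₗ Δ
  comul_mul : Δ ∘ₗ μ
      = TensorProduct.map μ μ ∘ₗ ttc k H H H H ∘ₗ TensorProduct.map Δ Δ

/-- Left module over a Hom-(bi)algebra. -/
structure IsHomModule (μ : H ⊗[k] H →ₗ[k] H) (α : H →ₗ[k] H)
    (ρ : H ⊗[k] M →ₗ[k] M) (αM : M →ₗ[k] M) : Prop where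
  str_compat : ∀ (h : H) (m : M), αM (ρ (h ⊗ₜ[k] m)) = ρ (α h ⊗ₜ[k] αM m)
  hom_smul : ∀ (h h' : H) (m : M),
      ρ (α h ⊗ₜ[k] ρ (h' ⊗ₜ[k] m)) = ρ (μ (h ⊗ₜ[k] h') ⊗ₜ[k] αM m)

/-- Left comodule over a Hom-(bi)algebra. -/
structure IsHomComodule (Δ : H →ₗ[k] H ⊗[k] H) (α : H →ₗ[k] H)
    (lM : M →ₗ[k] H ⊗[k] M) (αM : M →ₗ[k] M) : Prop where
  str_compat : TensorProduct.map α αM ∘ₗ lM = lM ∘ₗ αM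
  hom_coact : TensorProduct.map Δ αM ∘ₗ lM
      = (TensorProduct.assoc k H H M).symm.toLinearMap ∘ₗ TensorProduct.map α lM ∘ₗ lM

/-- `h ⊗ m ↦ (h₁·m)₍₋₁₎ β(h₂) ⊗ (h₁·m)₍₀₎`. -/
def ydL (μ : H ⊗[k] H →ₗ[k] H) (Δ : H →ₗ[k] H ⊗[k] H) (β : H →ₗ[k] H)
    (ρ : H ⊗[k] M →ₗ[k] M) (lM : M →ₗ[k] H ⊗[k] M) : H ⊗[k] M →ₗ[k] H ⊗[k] M :=
  TensorProduct.map μ LinearMap.id ∘ₗ rearr k H M H ∘ₗ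
    TensorProduct.map (lM ∘ₗ ρ) β ∘ₗ rearr k H H M ∘ₗ
      TensorProduct.map Δ LinearMap.id

/-- `h ⊗ m ↦ β(h₁) γ(m₍₋₁₎) ⊗ γ(h₂)·m₍₀₎`. -/
def ydR (μ : H ⊗[k] H →ₗ[k] H) (Δ : H →ₗ[k] H ⊗[k] H) (β γ : H →ₗ[k] H)
    (ρ : H ⊗[k] M →ₗ[k] M) (lM : M →ₗ[k] H ⊗[k] M) : H ⊗[k] M →ₗ[k] H ⊗[k] M :=
  TensorProduct.map (μ ∘ₗ TensorProduct.map β γ) (ρ ∘ₗ TensorProduct.map γ LinearMap.id) ∘ₗ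
    ttc k H H H M ∘ₗ TensorProduct.map Δ lM

/-- Yetter-Drinfeld module over a Hom-bialgebra: Hom-module, Hom-comodule and the
compatibility `(h₁·m)₍₋₁₎ α²(h₂) ⊗ (h₁·m)₍₀₎ = α²(h₁) α(m₍₋₁₎) ⊗ α(h₂)·m₍₀₎`. -/
def IsYetterDrinfeld (μ : H ⊗[k] H →ₗ[k] H) (Δ : H →ₗ[k] H ⊗[k] H) (α : H →ₗ[k] H)
    (ρ : H ⊗[k] M →ₗ[k] M) (lM : M →ₗ[k] H ⊗[k] M) (αM : M →ₗ[k] M) : Prop :=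
  IsHomModule k μ α ρ αM ∧ IsHomComodule k Δ α lM αM ∧
    ydL k μ Δ (α ∘ₗ α) ρ lM = ydR k μ Δ (α ∘ₗ α) α ρ lM

/-- `m ⊗ n ↦ αHinv(m₍₋₁₎)·n ⊗ m₍₀₎`. -/
def Bmap (αHinv : H →ₗ[k] H) (lM : M →ₗ[k] H ⊗[k] M) (ρN : H ⊗[k] N →ₗ[k] N) :
    M ⊗[k] N →ₗ[k] N ⊗[k] M :=
  TensorProduct.map (ρN ∘ₗ TensorProduct.map αHinv LinearMap.id) LinearMap.id ∘ₗ
    rearr k H M N ∘ₗ TensorProduct.map lM LinearMap.id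

/-- Quasi-braiding `m ⊗ n ↦ αN⁻¹(αH⁻¹(m₍₋₁₎)·n) ⊗ αM⁻¹(m₍₀₎)`. -/
def braidYD (αH : H ≃ₗ[k] H) (αM : M ≃ₗ[k] M) (αN : N ≃ₗ[k] N)
    (lM : M →ₗ[k] H ⊗[k] M) (ρN : H ⊗[k] N →ₗ[k] N) : M ⊗[k] N →ₗ[k] N ⊗[k] M :=
  TensorProduct.map
      (αN.symm.toLinearMap ∘ₗ ρN ∘ₗ TensorProduct.map αH.symm.toLinearMap LinearMap.id)
      αM.symm.toLinearMap ∘ₗ rearr k H M N ∘ₗ TensorProduct.map lM LinearMap.id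

/-- Action on `M ⊗ N`: `h ⊗ (m ⊗ n) ↦ h₁·m ⊗ h₂·n`. -/
def hatAction (Δ : H →ₗ[k] H ⊗[k] H)
    (ρM : H ⊗[k] M →ₗ[k] M) (ρN : H ⊗[k] N →ₗ[k] N) :
    H ⊗[k] (M ⊗[k] N) →ₗ[k] M ⊗[k] N :=
  TensorProduct.map ρM ρN ∘ₗ ttc k H H M N ∘ₗ TensorProduct.map Δ LinearMap.id

/-- Coaction on `M ⊗ N`: `m ⊗ n ↦ αHinv²(m₍₋₁₎ n₍₋₁₎) ⊗ (m₍₀₎ ⊗ n₍₀₎)`. -/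
def hatCoaction (μ : H ⊗[k] H →ₗ[k] H) (αHinv : H →ₗ[k] H)
    (lM : M →ₗ[k] H ⊗[k] M) (lN : N →ₗ[k] H ⊗[k] N) :
    M ⊗[k] N →ₗ[k] H ⊗[k] (M ⊗[k] N) :=
  TensorProduct.map (αHinv ∘ₗ αHinv ∘ₗ μ) LinearMap.id ∘ₗ ttc k H M H N ∘ₗ
    TensorProduct.map lM lN

/-- Action on `M ⊗ N`: `h ⊗ (m ⊗ n) ↦ αHinv²(h₁)·m ⊗ αHinv²(h₂)·n`. -/
def tildeAction (Δ : H →ₗ[k] H ⊗[k] H) (αHinv : H →ₗ[k] H)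
    (ρM : H ⊗[k] M →ₗ[k] M) (ρN : H ⊗[k] N →ₗ[k] N) :
    H ⊗[k] (M ⊗[k] N) →ₗ[k] M ⊗[k] N :=
  TensorProduct.map ρM ρN ∘ₗ ttc k H H M N ∘ₗ
    TensorProduct.map
      (TensorProduct.map (αHinv ∘ₗ αHinv) (αHinv ∘ₗ αHinv) ∘ₗ Δ) LinearMap.id

/-- Coaction on `M ⊗ N`: `m ⊗ n ↦ m₍₋₁₎ n₍₋₁₎ ⊗ (m₍₀₎ ⊗ n₍₀₎)`. -/
def tildeCoaction (μ : H ⊗[k] H →ₗ[k] H)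
    (lM : M →ₗ[k] H ⊗[k] M) (lN : N →ₗ[k] H ⊗[k] N) :
    M ⊗[k] N →ₗ[k] H ⊗[k] (M ⊗[k] N) :=
  TensorProduct.map μ LinearMap.id ∘ₗ ttc k H M H N ∘ₗ TensorProduct.map lM lN

/-- Associator `(x ⊗ y) ⊗ z ↦ αX⁻¹(x) ⊗ (y ⊗ αZ(z))`. -/
def aYD {X Z : Type*} [AddCommGroup X] [Module k X] [AddCommGroup Z] [Module k Z]
    (αX : X ≃ₗ[k] X) (Y : Type*) [AddCommGroup Y] [Module k Y] (αZ : Z ≃ₗ[k] Z) :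
    (X ⊗[k] Y) ⊗[k] Z →ₗ[k] X ⊗[k] (Y ⊗[k] Z) :=
  (TensorProduct.assoc k X Y Z).toLinearMap ∘ₗ
    TensorProduct.map (TensorProduct.map αX.symm.toLinearMap LinearMap.id) αZ.toLinearMap

/-- Inverse associator `x ⊗ (y ⊗ z) ↦ (αX(x) ⊗ y) ⊗ αZ⁻¹(z)`. -/
def aYDinv {X Z : Type*} [AddCommGroup X] [Module k X] [AddCommGroup Z] [Module k Z]
    (αX : X ≃ₗ[k] X) (Y : Type*) [AddCommGroup Y] [Module k Y] (αZ : Z ≃ₗ[k] Z) :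
    X ⊗[k] (Y ⊗[k] Z) →ₗ[k] (X ⊗[k] Y) ⊗[k] Z :=
  TensorProduct.map (TensorProduct.map αX.toLinearMap LinearMap.id) αZ.symm.toLinearMap ∘ₗ
    (TensorProduct.assoc k X Y Z).symm.toLinearMap

/-- Associator `(x ⊗ y) ⊗ z ↦ αX(x) ⊗ (y ⊗ αZ⁻¹(z))`. -/
def aTilde {X Z : Type*} [AddCommGroup X] [Module k X] [AddCommGroup Z] [Module k Z]
    (αX : X ≃ₗ[k] X) (Y : Type*) [AddCommGroup Y] [Module k Y] (αZ : Z ≃ₗ[k] Z) :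
    (X ⊗[k] Y) ⊗[k] Z →ₗ[k] X ⊗[k] (Y ⊗[k] Z) :=
  (TensorProduct.assoc k X Y Z).toLinearMap ∘ₗ
    TensorProduct.map (TensorProduct.map αX.toLinearMap LinearMap.id) αZ.symm.toLinearMap

/-- Inverse associator `x ⊗ (y ⊗ z) ↦ (αX⁻¹(x) ⊗ y) ⊗ αZ(z)`. -/
def aTildeInv {X Z : Type*} [AddCommGroup X] [Module k X] [AddCommGroup Z] [Module k Z]
    (αX : X ≃ₗ[k] X) (Y : Type*) [AddCommGroup Y] [Module k Y] (αZ : Z ≃ₗ[k] Z) :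
    X ⊗[k] (Y ⊗[k] Z) →ₗ[k] (X ⊗[k] Y) ⊗[k] Z :=
  TensorProduct.map (TensorProduct.map αX.symm.toLinearMap LinearMap.id) αZ.toLinearMap ∘ₗ
    (TensorProduct.assoc k X Y Z).symm.toLinearMap

/-- Quasitriangular Hom-bialgebra. -/
def IsQuasitriangular (μ : H ⊗[k] H →ₗ[k] H) (Δ : H →ₗ[k] H ⊗[k] H) (α : H →ₗ[k] H)
    (R : H ⊗[k] H) : Prop :=
  IsHomBialgebra k μ Δ α ∧
  TensorProduct.map Δ α R
    = TensorProduct.map (TensorProduct.map α α) μ (ttc k H H H H (R ⊗ₜ[k] R)) ∧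
  TensorProduct.map α Δ R
    = TensorProduct.map μ (TensorProduct.map α α ∘ₗ (TensorProduct.comm k H H).toLinearMap)
        (ttc k H H H H (R ⊗ₜ[k] R)) ∧
  ∀ h : H, TensorProduct.map μ μ (ttc k H H H H ((TensorProduct.comm k H H (Δ h)) ⊗ₜ[k] R))
      = TensorProduct.map μ μ (ttc k H H H H (R ⊗ₜ[k] Δ h))

/-- Coaction induced by an R-matrix: `m ↦ α(R²) ⊗ R¹·m`. -/
def coactionFromR (R : H ⊗[k] H) (α : H →ₗ[k] H) (ρM : H ⊗[k] M →ₗ[k] M) :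
    M →ₗ[k] H ⊗[k] M :=
  (TensorProduct.comm k M H).toLinearMap ∘ₗ TensorProduct.map ρM α ∘ₗ rearr k H H M ∘ₗ
    TensorProduct.mk k (H ⊗[k] H) M R

/-- Quasi-braiding from an R-matrix: `m ⊗ n ↦ αN⁻¹(R²·n) ⊗ αM⁻¹(R¹·m)`. -/
def braidR (R : H ⊗[k] H) (ρM : H ⊗[k] M →ₗ[k] M) (ρN : H ⊗[k] N →ₗ[k] N)
    (αM : M ≃ₗ[k] M) (αN : N ≃ₗ[k] N) : M ⊗[k] N →ₗ[k] N ⊗[k] M :=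
  TensorProduct.map αN.symm.toLinearMap αM.symm.toLinearMap ∘ₗ
    (TensorProduct.comm k M N).toLinearMap ∘ₗ TensorProduct.map ρM ρN ∘ₗ
      ttc k H H M N ∘ₗ TensorProduct.mk k (H ⊗[k] H) (M ⊗[k] N) R

/-- Coquasitriangular Hom-bialgebra. -/
def IsCoquasitriangular (μ : H ⊗[k] H →ₗ[k] H) (Δ : H →ₗ[k] H ⊗[k] H) (α : H →ₗ[k] H)
    (σ : H ⊗[k] H →ₗ[k] k) : Prop :=
  IsHomBialgebra k μ Δ α ∧
  (∀ x y z : H, σ (μ (x ⊗ₜ[k] y) ⊗ₜ[k] α z)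
      = LinearMap.mul' k k
          (TensorProduct.map σ σ (ttc k H H H H ((α x ⊗ₜ[k] α y) ⊗ₜ[k] Δ z)))) ∧
  (∀ x y z : H, σ (α x ⊗ₜ[k] μ (y ⊗ₜ[k] z))
      = LinearMap.mul' k k
          (TensorProduct.map σ σ (ttc k H H H H (Δ x ⊗ₜ[k] (α z ⊗ₜ[k] α y))))) ∧
  (∀ x y : H,
      (TensorProduct.rid k H)
        (TensorProduct.map (μ ∘ₗ (TensorProduct.comm k H H).toLinearMap) σ
          (ttc k H H H H (Δ x ⊗ₜ[k] Δ y)))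
      = (TensorProduct.lid k H)
          (TensorProduct.map σ μ (ttc k H H H H (Δ x ⊗ₜ[k] Δ y))))

/-- Action induced by a coquasitriangular form: `h ⊗ m ↦ σ(m₍₋₁₎ ⊗ α(h)) • m₍₀₎`. -/
def actionFromSigma (σ : H ⊗[k] H →ₗ[k] k) (α : H →ₗ[k] H)
    (lM : M →ₗ[k] H ⊗[k] M) : H ⊗[k] M →ₗ[k] M :=
  (TensorProduct.lid k M).toLinearMap ∘ₗ
    TensorProduct.map (σ ∘ₗ TensorProduct.map LinearMap.id α ∘ₗ
        (TensorProduct.comm k H H).toLinearMap) LinearMap.id ∘ₗ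
      (TensorProduct.assoc k H H M).symm.toLinearMap ∘ₗ
        TensorProduct.map LinearMap.id lM

/-- Quasi-braiding from a coquasitriangular form:
`m ⊗ n ↦ σ(n₍₋₁₎ ⊗ m₍₋₁₎) • (αN⁻¹(n₍₀₎) ⊗ αM⁻¹(m₍₀₎))`. -/
def braidSigma (σ : H ⊗[k] H →ₗ[k] k)
    (lM : M →ₗ[k] H ⊗[k] M) (lN : N →ₗ[k] H ⊗[k] N)
    (αM : M ≃ₗ[k] M) (αN : N ≃ₗ[k] N) : M ⊗[k] N →ₗ[k] N ⊗[k] M :=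
  (TensorProduct.lid k (N ⊗[k] M)).toLinearMap ∘ₗ
    TensorProduct.map (σ ∘ₗ (TensorProduct.comm k H H).toLinearMap)
      (TensorProduct.map αN.symm.toLinearMap αM.symm.toLinearMap ∘ₗ
        (TensorProduct.comm k M N).toLinearMap) ∘ₗ
      ttc k H M H N ∘ₗ TensorProduct.map lM lN


section Sweedler

variable {k} {P : Type*} [AddCommGroup P] [Module k P]

@[simp] lemma rearr_tmul {A B C : Type*} [AddCommGroup A] [Module k A] [AddCommGroup B]
    [Module k B] [AddCommGroup C] [Module k C] (a : A) (b : B) (c : C) :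
    rearr k A B C ((a ⊗ₜ[k] b) ⊗ₜ[k] c) = (a ⊗ₜ[k] c) ⊗ₜ[k] b := rfl

@[simp] lemma ttc_tmul {A B C D : Type*} [AddCommGroup A] [Module k A] [AddCommGroup B]
    [Module k B] [AddCommGroup C] [Module k C] [AddCommGroup D] [Module k D]
    (a : A) (b : B) (c : C) (d : D) :
    ttc k A B C D ((a ⊗ₜ[k] b) ⊗ₜ[k] (c ⊗ₜ[k] d)) = (a ⊗ₜ[k] c) ⊗ₜ[k] (b ⊗ₜ[k] d) := rfl

@[simp] lemma aTilde_tmul (αM : M ≃ₗ[k] M) (αP : P ≃ₗ[k] P) (m : M) (n : N) (p : P) :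
    aTilde k αM N αP ((m ⊗ₜ[k] n) ⊗ₜ[k] p) = αM m ⊗ₜ[k] (n ⊗ₜ[k] αP.symm p) := rfl

/-- The orbit map `h ↦ h·m`. -/
def orbit (ρ : H ⊗[k] M →ₗ[k] M) (m : M) : H →ₗ[k] M := ρ ∘ₗ (TensorProduct.mk k H M).flip m

@[simp] lemma orbit_apply (ρ : H ⊗[k] M →ₗ[k] M) (m : M) (h : H) :
    orbit ρ m h = ρ (h ⊗ₜ[k] m) := rfl

lemma tildeAction_tmul (Δ : H →ₗ[k] H ⊗[k] H) (β : H →ₗ[k] H)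
    (ρM : H ⊗[k] M →ₗ[k] M) (ρN : H ⊗[k] N →ₗ[k] N) (h : H) (m : M) (n : N) :
    tildeAction k Δ β ρM ρN (h ⊗ₜ[k] (m ⊗ₜ[k] n)) =
      TensorProduct.map (orbit ρM m ∘ₗ β ∘ₗ β) (orbit ρN n ∘ₗ β ∘ₗ β) (Δ h) := by
  simp only [tildeAction, LinearMap.comp_apply, TensorProduct.map_tmul, LinearMap.id_apply]
  induction Δ h using TensorProduct.induction_on with
  | zero => simp
  | tmul a b => simp
  | add x y hx hy => simp only [map_add, TensorProduct.add_tmul, hx, hy]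

lemma tildeCoaction_tmul (μ : H ⊗[k] H →ₗ[k] H)
    (lM : M →ₗ[k] H ⊗[k] M) (lN : N →ₗ[k] H ⊗[k] N) (m : M) (n : N) :
    tildeCoaction k μ lM lN (m ⊗ₜ[k] n) =
      TensorProduct.map μ LinearMap.id (ttc k H M H N (lM m ⊗ₜ[k] lN n)) := rfl

lemma braidYD_tmul (αH : H ≃ₗ[k] H) (αM : M ≃ₗ[k] M) (αN : N ≃ₗ[k] N)
    (lM : M →ₗ[k] H ⊗[k] M) (ρN : H ⊗[k] N →ₗ[k] N) (m : M) (n : N) :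
    braidYD k αH αM αN lM ρN (m ⊗ₜ[k] n) =
      TensorProduct.map (αN.symm.toLinearMap ∘ₗ orbit ρN n ∘ₗ αH.symm.toLinearMap)
        αM.symm.toLinearMap (lM m) := by
  simp only [braidYD, LinearMap.comp_apply, TensorProduct.map_tmul, LinearMap.id_apply]
  induction lM m using TensorProduct.induction_on with
  | zero => simp
  | tmul a b => simp
  | add x y hx hy => simp only [map_add, TensorProduct.add_tmul, hx, hy]

lemma ydL_tmul (μ : H ⊗[k] H →ₗ[k] H) (Δ : H →ₗ[k] H ⊗[k] H) (β : H →ₗ[k] H)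
    (ρ : H ⊗[k] M →ₗ[k] M) (lM : M →ₗ[k] H ⊗[k] M) (h : H) (m : M) :
    ydL k μ Δ β ρ lM (h ⊗ₜ[k] m) =
      TensorProduct.map μ LinearMap.id (rearr k H M H
        (TensorProduct.map (lM ∘ₗ orbit ρ m) β (Δ h))) := by
  simp only [ydL, LinearMap.comp_apply, TensorProduct.map_tmul, LinearMap.id_apply]
  induction Δ h using TensorProduct.induction_on with
  | zero => simp
  | tmul a b => simp
  | add x y hx hy => simp only [map_add, TensorProduct.add_tmul, hx, hy]

lemma ydR_tmul (μ : H ⊗[k] H →ₗ[k] H) (Δ : H →ₗ[k] H ⊗[k] H) (β γ : H →ₗ[k] H)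
    (ρ : H ⊗[k] M →ₗ[k] M) (lM : M →ₗ[k] H ⊗[k] M) (h : H) (m : M) :
    ydR k μ Δ β γ ρ lM (h ⊗ₜ[k] m) =
      TensorProduct.map (μ ∘ₗ TensorProduct.map β γ) (ρ ∘ₗ TensorProduct.map γ LinearMap.id)
        (ttc k H H H M (Δ h ⊗ₜ[k] lM m)) := rfl

/-- A linear map intertwining two invertible maps intertwines their inverses. -/
lemma intertwine_symm {V W : Type*} [AddCommGroup V] [Module k V] [AddCommGroup W] [Module k W]
    {f : V →ₗ[k] W} {a : V ≃ₗ[k] V} {b : W ≃ₗ[k] W} (h : ∀ v, b (f v) = f (a v)) (v : V) :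
    b.symm (f v) = f (a.symm v) := by
  rw [LinearEquiv.symm_apply_eq, h, LinearEquiv.apply_symm_apply]

variable {μ : H ⊗[k] H →ₗ[k] H} {Δ : H →ₗ[k] H ⊗[k] H} {αH : H ≃ₗ[k] H}

lemma IsHomBialgebra.symm_mul (hH : IsHomBialgebra k μ Δ αH.toLinearMap) (a b : H) :
    αH.symm (μ (a ⊗ₜ[k] b)) = μ (αH.symm a ⊗ₜ[k] αH.symm b) := by
  rw [LinearEquiv.symm_apply_eq]
  simpa using (hH.mul_mult (αH.symm a) (αH.symm b)).symm

lemma IsHomBialgebra.comul_symm (hH : IsHomBialgebra k μ Δ αH.toLinearMap) (h : H) :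
    Δ (αH.symm h) =
      TensorProduct.map αH.symm.toLinearMap αH.symm.toLinearMap (Δ h) :=
  (intertwine_symm (b := TensorProduct.congr αH αH)
    (fun v => LinearMap.congr_fun hH.comul_compat v) h).symm

variable {ρM : H ⊗[k] M →ₗ[k] M} {lM : M →ₗ[k] H ⊗[k] M} {αM : M ≃ₗ[k] M}

lemma IsHomModule.symm_smul (hM : IsHomModule k μ αH.toLinearMap ρM αM.toLinearMap)
    (h : H) (m : M) :
    αM.symm (ρM (h ⊗ₜ[k] m)) = ρM (αH.symm h ⊗ₜ[k] αM.symm m) := by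
  rw [LinearEquiv.symm_apply_eq]
  simpa using (hM.str_compat (αH.symm h) (αM.symm m)).symm

lemma IsHomModule.smul_smul (hM : IsHomModule k μ αH.toLinearMap ρM αM.toLinearMap)
    (h h' : H) (m : M) :
    ρM (h ⊗ₜ[k] ρM (h' ⊗ₜ[k] m)) = ρM (μ (αH.symm h ⊗ₜ[k] h') ⊗ₜ[k] αM m) := by
  simpa using hM.hom_smul (αH.symm h) h' m

lemma IsHomComodule.coact_str (hM : IsHomComodule k Δ αH.toLinearMap lM αM.toLinearMap)
    (m : M) :
    lM (αM m) = TensorProduct.map αH.toLinearMap αM.toLinearMap (lM m) :=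
  (LinearMap.congr_fun hM.str_compat m).symm

lemma IsHomComodule.coact_symm (hM : IsHomComodule k Δ αH.toLinearMap lM αM.toLinearMap)
    (m : M) :
    lM (αM.symm m) =
      TensorProduct.map αH.symm.toLinearMap αM.symm.toLinearMap (lM m) :=
  (intertwine_symm (b := TensorProduct.congr αH αM)
    (fun v => LinearMap.congr_fun hM.str_compat v) m).symm

variable {ρN : H ⊗[k] N →ₗ[k] N} {lN : N →ₗ[k] H ⊗[k] N} {αN : N ≃ₗ[k] N}
variable {ρP : H ⊗[k] P →ₗ[k] P} {lP : P →ₗ[k] H ⊗[k] P} {αP : P ≃ₗ[k] P}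

lemma aTilde_bijective (αM : M ≃ₗ[k] M) (αP : P ≃ₗ[k] P) :
    Function.Bijective (aTilde k αM N αP) :=
  ((TensorProduct.congr (TensorProduct.congr αM (LinearEquiv.refl k N)) αP.symm).trans
    (TensorProduct.assoc k M N P)).bijective

lemma aTilde_str (αM : M ≃ₗ[k] M) (αN : N ≃ₗ[k] N) (αP : P ≃ₗ[k] P) :
    TensorProduct.map αM.toLinearMap (TensorProduct.map αN.toLinearMap αP.toLinearMap) ∘ₗ
        aTilde k αM N αP
      = aTilde k αM N αP ∘ₗ
          TensorProduct.map (TensorProduct.map αM.toLinearMap αN.toLinearMap)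
            αP.toLinearMap := by
  refine TensorProduct.ext_threefold fun m n p => ?_
  simp

lemma aTilde_action (hH : IsHomBialgebra k μ Δ αH.toLinearMap)
    (hM : IsHomModule k μ αH.toLinearMap ρM αM.toLinearMap)
    (hP : IsHomModule k μ αH.toLinearMap ρP αP.toLinearMap) :
    aTilde k αM N αP ∘ₗ
        tildeAction k Δ αH.symm.toLinearMap (tildeAction k Δ αH.symm.toLinearMap ρM ρN) ρP
      = tildeAction k Δ αH.symm.toLinearMap ρM (tildeAction k Δ αH.symm.toLinearMap ρN ρP) ∘ₗ
          TensorProduct.map (LinearMap.id : H →ₗ[k] H) (aTilde k αM N αP) := by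
  refine TensorProduct.ext <| LinearMap.ext fun h => TensorProduct.ext_threefold fun m n p => ?_
  let β := αH.symm.toLinearMap
  let F : H ⊗[k] (H ⊗[k] H) →ₗ[k] M ⊗[k] (N ⊗[k] P) :=
    TensorProduct.map (orbit ρM (αM m) ∘ₗ β ∘ₗ β ∘ₗ β)
      (TensorProduct.map (orbit ρN n ∘ₗ β ∘ₗ β ∘ₗ β ∘ₗ β)
        (orbit ρP (αP.symm p) ∘ₗ β ∘ₗ β ∘ₗ β ∘ₗ β))
  have hl : ∀ t : H ⊗[k] H, aTilde k αM N αP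
      (TensorProduct.map (orbit (tildeAction k Δ β ρM ρN) (m ⊗ₜ[k] n) ∘ₗ β ∘ₗ β)
        (orbit ρP p ∘ₗ β ∘ₗ β) t) =
      F (TensorProduct.assoc k H H H (TensorProduct.map Δ αH.toLinearMap t)) := by
    intro t
    induction t using TensorProduct.induction_on with
    | zero => simp
    | add x y hx hy => simp only [map_add, hx, hy]
    | tmul a b =>
      simp only [TensorProduct.map_tmul, LinearMap.comp_apply, orbit_apply, tildeAction_tmul, β,
        LinearEquiv.coe_coe, hH.comul_symm]
      induction Δ a using TensorProduct.induction_on with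
      | zero => simp
      | add x y hx hy => simp only [map_add, TensorProduct.add_tmul, hx, hy]
      | tmul c d =>
        have h1 := hM.str_compat
        simp only [LinearEquiv.coe_coe] at h1
        simp [F, β, h1, hP.symm_smul]
  have hr : ∀ t : H ⊗[k] H,
      TensorProduct.map (orbit ρM (αM m) ∘ₗ β ∘ₗ β)
        (orbit (tildeAction k Δ β ρN ρP) (n ⊗ₜ[k] αP.symm p) ∘ₗ β ∘ₗ β) t =
      F (TensorProduct.map αH.toLinearMap Δ t) := by
    intro t
    induction t using TensorProduct.induction_on with
    | zero => simp
    | add x y hx hy => simp only [map_add, hx, hy]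
    | tmul a b =>
      simp only [TensorProduct.map_tmul, LinearMap.comp_apply, orbit_apply, tildeAction_tmul, β,
        LinearEquiv.coe_coe, hH.comul_symm]
      induction Δ b using TensorProduct.induction_on with
      | zero => simp
      | add x y hx hy => simp only [map_add, TensorProduct.tmul_add, hx, hy]
      | tmul c d => simp [F, β]
  have hc := congrArg F (LinearMap.congr_fun hH.hom_coassoc h)
  simpa [tildeAction_tmul, β] using (hl (Δ h)).trans (hc.trans (hr (Δ h)).symm)

lemma aTilde_coaction (hH : IsHomBialgebra k μ Δ αH.toLinearMap)
    (hM : IsHomComodule k Δ αH.toLinearMap lM αM.toLinearMap)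
    (hP : IsHomComodule k Δ αH.toLinearMap lP αP.toLinearMap) :
    TensorProduct.map (LinearMap.id : H →ₗ[k] H) (aTilde k αM N αP) ∘ₗ
        tildeCoaction k μ (tildeCoaction k μ lM lN) lP
      = tildeCoaction k μ lM (tildeCoaction k μ lN lP) ∘ₗ aTilde k αM N αP := by
  refine TensorProduct.ext_threefold fun m n p => ?_
  simp only [LinearMap.comp_apply, tildeCoaction_tmul, aTilde_tmul, hM.coact_str, hP.coact_symm]
  induction lM m using TensorProduct.induction_on with
  | zero => simp
  | add x y hx hy => simp only [map_add, TensorProduct.add_tmul, hx, hy]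
  | tmul a m' =>
    induction lN n using TensorProduct.induction_on with
    | zero => simp
    | add x y hx hy => simp only [map_add, TensorProduct.add_tmul, TensorProduct.tmul_add, hx, hy]
    | tmul b n' =>
      induction lP p using TensorProduct.induction_on with
      | zero => simp
      | add x y hx hy => simp only [map_add, TensorProduct.tmul_add, hx, hy]
      | tmul c p' =>
        have h1 := hH.hom_assoc a b (αH.symm c)
        simp only [LinearEquiv.coe_coe, LinearEquiv.apply_symm_apply] at h1
        simp [h1]

lemma braidYD_str (hM : IsHomComodule k Δ αH.toLinearMap lM αM.toLinearMap)
    (hN : IsHomModule k μ αH.toLinearMap ρN αN.toLinearMap) :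
    TensorProduct.map αN.toLinearMap αM.toLinearMap ∘ₗ braidYD k αH αM αN lM ρN
      = braidYD k αH αM αN lM ρN ∘ₗ TensorProduct.map αM.toLinearMap αN.toLinearMap := by
  refine TensorProduct.ext' fun m n => ?_
  simp only [LinearMap.comp_apply, TensorProduct.map_tmul, braidYD_tmul, LinearEquiv.coe_coe,
    hM.coact_str]
  induction lM m using TensorProduct.induction_on with
  | zero => simp
  | add x y hx hy => simp only [map_add, hx, hy]
  | tmul a m' =>
    have h1 := hN.str_compat
    simp only [LinearEquiv.coe_coe] at h1
    simp [hN.symm_smul, h1]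

lemma braidYD_action (hH : IsHomBialgebra k μ Δ αH.toLinearMap)
    (hM : IsYetterDrinfeld k μ Δ αH.toLinearMap ρM lM αM.toLinearMap)
    (hN : IsHomModule k μ αH.toLinearMap ρN αN.toLinearMap) :
    braidYD k αH αM αN lM ρN ∘ₗ tildeAction k Δ αH.symm.toLinearMap ρM ρN
      = tildeAction k Δ αH.symm.toLinearMap ρN ρM ∘ₗ
          TensorProduct.map (LinearMap.id : H →ₗ[k] H) (braidYD k αH αM αN lM ρN) := by
  obtain ⟨hMa, -, hMy⟩ := hM
  refine TensorProduct.ext <| LinearMap.ext fun h => TensorProduct.ext' fun m n => ?_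
  let β := αH.symm.toLinearMap
  let G : H ⊗[k] M →ₗ[k] N ⊗[k] M :=
    TensorProduct.map (orbit ρN n ∘ₗ β ∘ₗ β ∘ₗ β) αM.symm.toLinearMap
  have hl : braidYD k αH αM αN lM ρN
        (tildeAction k Δ αH.symm.toLinearMap ρM ρN (h ⊗ₜ[k] (m ⊗ₜ[k] n))) =
      G (ydL k μ Δ (αH.toLinearMap ∘ₗ αH.toLinearMap) ρM lM (β (β h) ⊗ₜ[k] m)) := by
    simp only [tildeAction_tmul, ydL_tmul, β, LinearEquiv.coe_coe, hH.comul_symm]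
    induction Δ h using TensorProduct.induction_on with
    | zero => simp
    | add x y hx hy => simp only [map_add, hx, hy]
    | tmul a b =>
      simp only [TensorProduct.map_tmul, LinearMap.comp_apply, orbit_apply, braidYD_tmul,
        LinearEquiv.coe_coe]
      induction lM (ρM (αH.symm (αH.symm a) ⊗ₜ[k] m)) using TensorProduct.induction_on with
      | zero => simp
      | add x y hx hy => simp only [map_add, TensorProduct.add_tmul, hx, hy]
      | tmul c m' => simp [G, β, hN.symm_smul, hN.smul_smul, hH.symm_mul]
  have hr : tildeAction k Δ αH.symm.toLinearMap ρN ρM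
        (h ⊗ₜ[k] braidYD k αH αM αN lM ρN (m ⊗ₜ[k] n)) =
      G (ydR k μ Δ (αH.toLinearMap ∘ₗ αH.toLinearMap) αH.toLinearMap ρM lM
        (β (β h) ⊗ₜ[k] m)) := by
    simp only [ydR_tmul, braidYD_tmul, β, LinearEquiv.coe_coe, hH.comul_symm]
    induction lM m using TensorProduct.induction_on with
    | zero => simp
    | add x y hx hy => simp only [map_add, TensorProduct.tmul_add, hx, hy]
    | tmul c m' =>
      simp only [TensorProduct.map_tmul, tildeAction_tmul]
      induction Δ h using TensorProduct.induction_on with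
      | zero => simp
      | add x y hx hy => simp only [map_add, TensorProduct.add_tmul, hx, hy]
      | tmul a b => simp [G, β, hN.symm_smul, hN.smul_smul, hMa.symm_smul, hH.symm_mul]
  exact hl.trans ((congrArg G (LinearMap.congr_fun hMy _)).trans hr.symm)

lemma braidYD_coaction (hH : IsHomBialgebra k μ Δ αH.toLinearMap)
    (hM : IsHomComodule k Δ αH.toLinearMap lM αM.toLinearMap)
    (hN : IsYetterDrinfeld k μ Δ αH.toLinearMap ρN lN αN.toLinearMap) :
    TensorProduct.map (LinearMap.id : H →ₗ[k] H) (braidYD k αH αM αN lM ρN) ∘ₗ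
        tildeCoaction k μ lM lN
      = tildeCoaction k μ lN lM ∘ₗ braidYD k αH αM αN lM ρN := by
  obtain ⟨hNa, hNc, hNy⟩ := hN
  refine TensorProduct.ext' fun m n => ?_
  let β := αH.symm.toLinearMap
  let S : H ⊗[k] (H ⊗[k] M) →ₗ[k] H ⊗[k] (N ⊗[k] M) :=
    TensorProduct.map (μ ∘ₗ TensorProduct.map β LinearMap.id)
      (TensorProduct.map (αN.symm.toLinearMap ∘ₗ ρN ∘ₗ TensorProduct.map β LinearMap.id)
        αM.symm.toLinearMap ∘ₗ rearr k H M N) ∘ₗ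
      ttc k H (H ⊗[k] M) H N ∘ₗ (TensorProduct.mk k (H ⊗[k] (H ⊗[k] M)) (H ⊗[k] N)).flip (lN n)
  let T : H ⊗[k] (H ⊗[k] M) →ₗ[k] H ⊗[k] (N ⊗[k] M) :=
    TensorProduct.map μ LinearMap.id ∘ₗ ttc k H N H M ∘ₗ
      TensorProduct.map
        (TensorProduct.map β αN.symm.toLinearMap ∘ₗ lN ∘ₗ orbit ρN n ∘ₗ β ∘ₗ β)
        (TensorProduct.map β αM.symm.toLinearMap)
  let K : (H ⊗[k] N) ⊗[k] M →ₗ[k] H ⊗[k] (N ⊗[k] M) :=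
    (TensorProduct.assoc k H N M).toLinearMap ∘ₗ TensorProduct.map
      (TensorProduct.map β αN.symm.toLinearMap) LinearMap.id
  have hl : TensorProduct.map (LinearMap.id : H →ₗ[k] H) (braidYD k αH αM αN lM ρN)
      (tildeCoaction k μ lM lN (m ⊗ₜ[k] n)) =
      S (TensorProduct.map αH.toLinearMap lM (lM m)) := by
    simp only [tildeCoaction_tmul, S, LinearMap.comp_apply, LinearMap.flip_apply,
      TensorProduct.mk_apply]
    induction lM m using TensorProduct.induction_on with
    | zero => simp
    | add x y hx hy => simp only [map_add, TensorProduct.add_tmul, hx, hy]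
    | tmul a m' =>
      induction lN n using TensorProduct.induction_on with
      | zero => simp
      | add x y hx hy => simp only [map_add, TensorProduct.tmul_add, hx, hy]
      | tmul c n' =>
        simp only [TensorProduct.map_tmul, ttc_tmul, braidYD_tmul, LinearMap.id_apply]
        induction lM m' using TensorProduct.induction_on with
        | zero => simp
        | add x y hx hy =>
          simp only [map_add, TensorProduct.add_tmul, TensorProduct.tmul_add, hx, hy]
        | tmul b m'' => simp [β]
  have hr : tildeCoaction k μ lN lM (braidYD k αH αM αN lM ρN (m ⊗ₜ[k] n)) =
      T (TensorProduct.map αH.toLinearMap lM (lM m)) := by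
    rw [braidYD_tmul]
    induction lM m using TensorProduct.induction_on with
    | zero => simp
    | add x y hx hy => simp only [map_add, hx, hy]
    | tmul a m' => simp [T, β, tildeCoaction_tmul, hNc.coact_symm, hM.coact_symm]
  have hST : ∀ t : H ⊗[k] M,
      S (TensorProduct.assoc k H H M (TensorProduct.map Δ αM.toLinearMap t)) =
        T (TensorProduct.assoc k H H M (TensorProduct.map Δ αM.toLinearMap t)) := by
    intro t
    induction t using TensorProduct.induction_on with
    | zero => simp
    | add x y hx hy => simp only [map_add, hx, hy]
    | tmul a m' =>
      have hS : S (TensorProduct.assoc k H H M (Δ a ⊗ₜ[k] αM m')) =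
          K (ydR k μ Δ (αH.toLinearMap ∘ₗ αH.toLinearMap) αH.toLinearMap ρN lN
            (β (β a) ⊗ₜ[k] n) ⊗ₜ[k] m') := by
        simp only [ydR_tmul, S, β, LinearEquiv.coe_coe, hH.comul_symm, LinearMap.comp_apply,
          LinearMap.flip_apply, TensorProduct.mk_apply]
        induction Δ a using TensorProduct.induction_on with
        | zero => simp
        | add x y hx hy => simp only [map_add, TensorProduct.add_tmul, hx, hy]
        | tmul b c =>
          induction lN n using TensorProduct.induction_on with
          | zero => simp
          | add x y hx hy =>
            simp only [map_add, TensorProduct.add_tmul, TensorProduct.tmul_add, hx, hy]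
          | tmul d n' => simp [K, β, hNa.symm_smul, hH.symm_mul]
      have hT : T (TensorProduct.assoc k H H M (Δ a ⊗ₜ[k] αM m')) =
          K (ydL k μ Δ (αH.toLinearMap ∘ₗ αH.toLinearMap) ρN lN
            (β (β a) ⊗ₜ[k] n) ⊗ₜ[k] m') := by
        simp only [ydL_tmul, β, LinearEquiv.coe_coe, hH.comul_symm]
        induction Δ a using TensorProduct.induction_on with
        | zero => simp
        | add x y hx hy => simp only [map_add, TensorProduct.add_tmul, hx, hy]
        | tmul b c =>
          simp only [T, β, TensorProduct.assoc_tmul, TensorProduct.map_tmul,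
            LinearMap.comp_apply, orbit_apply, LinearEquiv.coe_coe]
          induction lN (ρN (αH.symm (αH.symm b) ⊗ₜ[k] n)) using TensorProduct.induction_on with
          | zero => simp
          | add x y hx hy => simp only [map_add, TensorProduct.add_tmul, hx, hy]
          | tmul d n' => simp [K, β, hH.symm_mul]
      rw [TensorProduct.map_tmul, LinearEquiv.coe_coe, hS, hT, hNy]
  have hc : TensorProduct.map αH.toLinearMap lM (lM m) =
      TensorProduct.assoc k H H M (TensorProduct.map Δ αM.toLinearMap (lM m)) :=
    ((TensorProduct.assoc k H H M).eq_symm_apply.mp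
      (LinearMap.congr_fun hM.hom_coact m)).symm
  rw [LinearMap.comp_apply, LinearMap.comp_apply, hl, hr, hc, hST]

end Sweedler

/-- the associator `𝔞_{M,N,P}((m⊗n)⊗p) = αM(m) ⊗ (n ⊗ αP⁻¹(p))` is a
bijective morphism of left H-modules and left H-comodules for the iterated ⊗̃ structures,
and the quasi-braiding `c_{M,N}(m⊗n) = αN⁻¹(αH⁻¹(m₍₋₁₎)·n) ⊗ αM⁻¹(m₍₀₎)` is a morphism of
left H-modules and left H-comodules `M ⊗̃ N → N ⊗̃ M`. -/
theorem stmt15 {k H M N P : Type*} [Field k]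
    [AddCommGroup H] [Module k H] [AddCommGroup M] [Module k M]
    [AddCommGroup N] [Module k N] [AddCommGroup P] [Module k P]
    (μ : H ⊗[k] H →ₗ[k] H) (Δ : H →ₗ[k] H ⊗[k] H) (αH : H ≃ₗ[k] H)
    (hH : IsHomBialgebra k μ Δ αH.toLinearMap)
    (ρM : H ⊗[k] M →ₗ[k] M) (lM : M →ₗ[k] H ⊗[k] M) (αM : M ≃ₗ[k] M)
    (hM : IsYetterDrinfeld k μ Δ αH.toLinearMap ρM lM αM.toLinearMap)
    (ρN : H ⊗[k] N →ₗ[k] N) (lN : N →ₗ[k] H ⊗[k] N) (αN : N ≃ₗ[k] N)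
    (hN : IsYetterDrinfeld k μ Δ αH.toLinearMap ρN lN αN.toLinearMap)
    (ρP : H ⊗[k] P →ₗ[k] P) (lP : P →ₗ[k] H ⊗[k] P) (αP : P ≃ₗ[k] P)
    (hP : IsYetterDrinfeld k μ Δ αH.toLinearMap ρP lP αP.toLinearMap) :
    Function.Bijective (aTilde k αM N αP) ∧
    (TensorProduct.map αM.toLinearMap (TensorProduct.map αN.toLinearMap αP.toLinearMap) ∘ₗ
        aTilde k αM N αP
      = aTilde k αM N αP ∘ₗ
          TensorProduct.map (TensorProduct.map αM.toLinearMap αN.toLinearMap) αP.toLinearMap) ∧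
    (aTilde k αM N αP ∘ₗ
        tildeAction k Δ αH.symm.toLinearMap (tildeAction k Δ αH.symm.toLinearMap ρM ρN) ρP
      = tildeAction k Δ αH.symm.toLinearMap ρM (tildeAction k Δ αH.symm.toLinearMap ρN ρP) ∘ₗ
          TensorProduct.map (LinearMap.id : H →ₗ[k] H) (aTilde k αM N αP)) ∧
    (TensorProduct.map (LinearMap.id : H →ₗ[k] H) (aTilde k αM N αP) ∘ₗ
        tildeCoaction k μ (tildeCoaction k μ lM lN) lP
      = tildeCoaction k μ lM (tildeCoaction k μ lN lP) ∘ₗ aTilde k αM N αP) ∧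
    (TensorProduct.map αN.toLinearMap αM.toLinearMap ∘ₗ braidYD k αH αM αN lM ρN
      = braidYD k αH αM αN lM ρN ∘ₗ TensorProduct.map αM.toLinearMap αN.toLinearMap) ∧
    (braidYD k αH αM αN lM ρN ∘ₗ tildeAction k Δ αH.symm.toLinearMap ρM ρN
      = tildeAction k Δ αH.symm.toLinearMap ρN ρM ∘ₗ
          TensorProduct.map (LinearMap.id : H →ₗ[k] H) (braidYD k αH αM αN lM ρN)) ∧
    (TensorProduct.map (LinearMap.id : H →ₗ[k] H) (braidYD k αH αM αN lM ρN) ∘ₗ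
        tildeCoaction k μ lM lN
      = tildeCoaction k μ lN lM ∘ₗ braidYD k αH αM αN lM ρN) :=
  ⟨aTilde_bijective αM αP, aTilde_str αM αN αP, aTilde_action hH hM.1 hP.1,
    aTilde_coaction hH hM.2.1 hP.2.1, braidYD_str hM.2.1 hN.1, braidYD_action hH hM hN.1,
    braidYD_coaction hH hM.2.1 hN⟩

end HomYD
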